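/- arXiv:1709.04992 — 9 statements merged into one kernel-verified Lean document; each statement's English description precedes it below -/
import Mathlib

section
/- Let J : ℝⁿ → ℝ ∪ {+∞} be coercive, proper, lower semicontinuous, and continuous on its domain dom J = {v : J(v) < ∞}, and let V₁,…,V_m be subspaces of ℝⁿ such that for every w ∈ dom J and every k, the function v ↦ J(w + v) has a unique global minimizer over V_k. Let M_k : dom J → dom J with M_k(v) − v ∈ V_k be given operators, let C : dom J → dom J be any operator, and for an initial iterate u⁰ ∈ dom J define the sequence u^{ν+1/2} = (M_m ∘ ⋯ ∘ M₁)(u^ν), u^{ν+1} = C(u^{ν+1/2}). Assume there exist operators M̃_k : dom J → dom J with M̃_k(v) − v ∈ V_k such that: (1) Monotonicity: J(M_k(v)) ≤ J(M̃_k(v)) ≤ J(v) and J(C(v)) ≤ J(v) for all v ∈ dom J; (2) Continuity: J ∘ M̃_k is continuous on dom J; (3) Stability: J(M̃_k(v)) < J(v) whenever J(v) is not minimal over v + V_k. Then every accumulation point u of the sequence (u^ν) is stationary in the sense that J(u) ≤ J(u + v) for all v ∈ V_k and all k = 1,…,m. -/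
open Filter Topology

/-- A sequence that corrects a convergent sequence inside a subspace and whose energies tend to
the energy of the limit converges to the same limit, provided that this limit is the strict
minimizer of the lower semicontinuous energy in its affine subspace. -/
theorem tendsto_of_subspace_correction {ι E : Type*} [NormedAddCommGroup E] [NormedSpace ℝ E]
    [FiniteDimensional ℝ E] {J : E → EReal} (hlsc : LowerSemicontinuous J) (V : Submodule ℝ E)
    {l : Filter ι} {x y : ι → E} {a : E} (hx : Tendsto x l (𝓝 a)) (hxy : ∀ i, y i - x i ∈ V)
    (hJ : Tendsto (fun i => J (y i)) l (𝓝 (J a))) {K : Set E} (hK : IsCompact K)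
    (hyK : ∀ i, y i ∈ K) (hstrict : ∀ z, z - a ∈ V → J z ≤ J a → z = a) :
    Tendsto y l (𝓝 a) := by
  refine hK.tendsto_nhds_of_unique_mapClusterPt (Eventually.of_forall hyK) fun w _ hw => ?_
  obtain ⟨U, hUl, hU⟩ := mapClusterPt_iff_ultrafilter.1 hw
  refine hstrict w ?_ ?_
  · exact V.closed_of_finiteDimensional.mem_of_tendsto (hU.sub (hx.mono_left hUl))
      (Eventually.of_forall hxy)
  · refine le_of_forall_lt fun c hc => ?_
    obtain ⟨d, hcd, hdw⟩ := exists_between hc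
    refine hcd.trans_le (ge_of_tendsto (hJ.mono_left hUl) ?_)
    exact (hU.eventually (hlsc w d hdw)).mono fun _ h => h.le

/-- The sublevel sets of a coercive lower semicontinuous function on a finite-dimensional space
are compact. -/
theorem isCompact_sublevel_of_coercive {E : Type*} [NormedAddCommGroup E] [NormedSpace ℝ E]
    [FiniteDimensional ℝ E] {J : E → EReal} (hlsc : LowerSemicontinuous J)
    (hcoercive : ∀ c : ℝ, ∃ r : ℝ, ∀ x : E, r ≤ ‖x‖ → (c : EReal) ≤ J x)
    {b : EReal} (hb : b ≠ ⊤) : IsCompact {x | J x ≤ b} := by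
  have := FiniteDimensional.proper ℝ E
  obtain ⟨c, hc, -⟩ := EReal.lt_iff_exists_real_btwn.1 hb.lt_top
  obtain ⟨r, hr⟩ := hcoercive c
  refine (isCompact_closedBall (0 : E) r).of_isClosed_subset (hlsc.isClosed_preimage b) ?_
  intro x hx
  rw [mem_closedBall_zero_iff]
  by_contra! h
  exact absurd (hx.trans_lt hc) (hr x h.le).not_gt

/-- A composition of descent operators is a descent operator. -/
theorem foldl_descent {κ E β : Type*} [PartialOrder β] [OrderTop β] {J : E → β}
    {M : κ → E → E} (hM : ∀ k v, J v ≠ ⊤ → J (M k v) ≤ J v) (L : List κ) :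
    ∀ v, J v ≠ ⊤ → J (L.foldl (fun w k => M k w) v) ≤ J v := by
  induction L with
  | nil => exact fun v _ => le_rfl
  | cons k L ih =>
    intro v hv
    have h := hM k v hv
    exact (ih (M k v) (ne_top_of_le_ne_top hv h)).trans h

/-- If a nonlinear Gauß–Seidel sweep over the list `L`, applied along a sequence converging to
`a`, never reaches energies below `J a`, then `a` is stationary for all subspaces in `L`. -/
theorem stationary_of_le_foldl {κ E : Type*} [NormedAddCommGroup E] [NormedSpace ℝ E]
    [FiniteDimensional ℝ E] {J : E → EReal} (hlsc : LowerSemicontinuous J)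
    (hcoercive : ∀ c : ℝ, ∃ r : ℝ, ∀ x : E, r ≤ ‖x‖ → (c : EReal) ≤ J x)
    (hcont : ContinuousOn J {x | J x ≠ ⊤}) {V : κ → Submodule ℝ E} {M N : κ → E → E}
    (hMsub : ∀ k v, J v ≠ ⊤ → M k v - v ∈ V k)
    (hmono : ∀ k v, J v ≠ ⊤ → J (M k v) ≤ J (N k v) ∧ J (N k v) ≤ J v)
    (hNcont : ∀ k, ContinuousOn (fun v => J (N k v)) {x | J x ≠ ⊤})
    (hstable : ∀ k v, J v ≠ ⊤ → (∃ x ∈ V k, J (v + x) < J v) → J (N k v) < J v)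
    {a : E} (ha : J a ≠ ⊤)
    (huniq : ∀ k, ∃! z : E, z - a ∈ V k ∧ ∀ v ∈ V k, J z ≤ J (a + v))
    {b : EReal} (hb : b ≠ ⊤) (L : List κ) :
    ∀ x : ℕ → E, (∀ i, J (x i) ≤ b) → Tendsto x atTop (𝓝 a) →
      (∀ i, J a ≤ J (L.foldl (fun w k => M k w) (x i))) →
      ∀ k ∈ L, ∀ v ∈ V k, J a ≤ J (a + v) := by
  have hM : ∀ k v, J v ≠ ⊤ → J (M k v) ≤ J v := fun k v hv =>
    (hmono k v hv).1.trans (hmono k v hv).2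
  induction L with
  | nil => simp
  | cons k L ih =>
    intro x hxb hx hge
    have hdom : ∀ i, J (x i) ≠ ⊤ := fun i => ne_top_of_le_ne_top hb (hxb i)
    have hxw : Tendsto x atTop (𝓝[{x | J x ≠ ⊤}] a) :=
      tendsto_nhdsWithin_iff.2 ⟨hx, Eventually.of_forall hdom⟩
    have hyb : ∀ i, J (M k (x i)) ≤ b := fun i => (hM k _ (hdom i)).trans (hxb i)
    have hay : ∀ i, J a ≤ J (M k (x i)) := fun i =>
      (hge i).trans (foldl_descent hM L _ (ne_top_of_le_ne_top hb (hyb i)))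
    have hstat : ∀ v ∈ V k, J a ≤ J (a + v) := by
      have hN : J a ≤ J (N k a) := ge_of_tendsto ((hNcont k a ha).tendsto.comp hxw)
        (Eventually.of_forall fun i => (hay i).trans (hmono k _ (hdom i)).1)
      intro v hv
      by_contra! h
      exact (hstable k a ha ⟨v, hv, h⟩).not_ge hN
    have hJy : Tendsto (fun i => J (M k (x i))) atTop (𝓝 (J a)) :=
      tendsto_of_tendsto_of_tendsto_of_le_of_le tendsto_const_nhds
        ((hcont a ha).tendsto.comp hxw) hay fun i => hM k _ (hdom i)
    have hy : Tendsto (fun i => M k (x i)) atTop (𝓝 a) :=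
      tendsto_of_subspace_correction hlsc (V k) hx (fun i => hMsub k _ (hdom i)) hJy
        (isCompact_sublevel_of_coercive hlsc hcoercive hb) hyb fun z hz hza =>
          (huniq k).unique ⟨hz, fun v hv => hza.trans (hstat v hv)⟩ ⟨by simp, hstat⟩
    intro j hj
    rcases List.mem_cons.1 hj with rfl | hj
    · exact hstat
    · exact ih _ hyb hy hge j hj


/-- **Global convergence of TNNMG (Theorem `thm:gs_stationary`).**
Let `J : ℝⁿ → ℝ ∪ {∞}` be coercive, proper, lower semicontinuous, continuous on its domain,
and such that `J (w + ·)` has a unique global minimizer in every subspace `V k` for every `w`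
in the domain.  Given inexact local solvers `Mop k` (with corrections in `V k`), a correction
operator `C`, bounding operators `Mt k` satisfying monotonicity, continuity of `J ∘ Mt k`, and
stability, the TNNMG sequence `u (ν+1) = C ((Mop m ∘ ⋯ ∘ Mop 1) (u ν))` has only stationary
accumulation points: `J ubar ≤ J (ubar + v)` for all `v ∈ V k` and all `k`. -/
theorem tnnmg_accumulation_points_stationary
    {n m : ℕ}
    (J : EuclideanSpace ℝ (Fin n) → EReal)
    (hproper : ∃ x, J x ≠ ⊤)
    (hnobot : ∀ x, J x ≠ ⊥)
    (hcoercive : ∀ c : ℝ, ∃ r : ℝ, ∀ x : EuclideanSpace ℝ (Fin n), r ≤ ‖x‖ → (c : EReal) ≤ J x)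
    (hlsc : LowerSemicontinuous J)
    (hcont : ContinuousOn J {x | J x ≠ ⊤})
    (V : Fin m → Submodule ℝ (EuclideanSpace ℝ (Fin n)))
    (huniq : ∀ w, J w ≠ ⊤ → ∀ k : Fin m,
      ∃! z : EuclideanSpace ℝ (Fin n), z - w ∈ V k ∧ ∀ v ∈ V k, J z ≤ J (w + v))
    (Mop Mt : Fin m → EuclideanSpace ℝ (Fin n) → EuclideanSpace ℝ (Fin n))
    (C : EuclideanSpace ℝ (Fin n) → EuclideanSpace ℝ (Fin n))
    (hMsub : ∀ (k : Fin m) v, J v ≠ ⊤ → Mop k v - v ∈ V k)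
    (hMtsub : ∀ (k : Fin m) v, J v ≠ ⊤ → Mt k v - v ∈ V k)
    (hmono : ∀ (k : Fin m) v, J v ≠ ⊤ → J (Mop k v) ≤ J (Mt k v) ∧ J (Mt k v) ≤ J v)
    (hCmono : ∀ v, J v ≠ ⊤ → J (C v) ≤ J v)
    (hMtcont : ∀ k : Fin m, ContinuousOn (fun v => J (Mt k v)) {x | J x ≠ ⊤})
    (hstable : ∀ (k : Fin m) v, J v ≠ ⊤ → (∃ x ∈ V k, J (v + x) < J v) → J (Mt k v) < J v)
    (u : ℕ → EuclideanSpace ℝ (Fin n))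
    (hu0 : J (u 0) ≠ ⊤)
    (hiter : ∀ ν : ℕ,
      u (ν + 1) = C ((List.finRange m).foldl (fun w k => Mop k w) (u ν)))
    (ubar : EuclideanSpace ℝ (Fin n))
    (σ : ℕ → ℕ) (hσ : StrictMono σ)
    (hacc : Filter.Tendsto (u ∘ σ) Filter.atTop (nhds ubar)) :
    ∀ k : Fin m, ∀ v ∈ V k, J ubar ≤ J (ubar + v) := by
  have hM : ∀ k v, J v ≠ ⊤ → J (Mop k v) ≤ J v := fun k v hv =>
    (hmono k v hv).1.trans (hmono k v hv).2
  have hstep : ∀ ν, J (u ν) ≠ ⊤ →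
      J (u (ν + 1)) ≤ J ((List.finRange m).foldl (fun w k => Mop k w) (u ν)) := fun ν hν => by
    rw [hiter]
    exact hCmono _ (ne_top_of_le_ne_top hν (foldl_descent hM _ _ hν))
  have hdom : ∀ ν, J (u ν) ≠ ⊤ := by
    intro ν
    induction ν with
    | zero => exact hu0
    | succ ν ih => exact ne_top_of_le_ne_top ih ((hstep ν ih).trans (foldl_descent hM _ _ ih))
  have hanti : Antitone fun ν => J (u ν) := antitone_nat_of_succ_le fun ν =>
    (hstep ν (hdom ν)).trans (foldl_descent hM _ _ (hdom ν))
  have hle : ∀ ν, J ubar ≤ J (u ν) := fun ν =>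
    (hlsc.isClosed_preimage (J (u ν))).mem_of_tendsto hacc <|
      (eventually_ge_atTop ν).mono fun j hj => hanti (hj.trans (hσ.id_le j))
  have hbar : J ubar ≠ ⊤ := ne_top_of_le_ne_top hu0 (hle 0)
  intro k
  exact stationary_of_le_foldl hlsc hcoercive hcont hMsub hmono hMtcont hstable hbar
    (huniq ubar hbar) hu0 (List.finRange m) (u ∘ σ) (fun i => hanti (Nat.zero_le _)) hacc
    (fun i => (hle _).trans (hstep _ (hdom _))) k (List.mem_finRange k)
end

section
/- Under the assumptions of the TNNMG convergence theorem (J : ℝⁿ → ℝ ∪ {+∞} coercive, proper, lower semicontinuous, continuous on its domain; unique minimizers of J(w + ·) in each V_k; operators M_k, M̃_k, C satisfying monotonicity, continuity of J ∘ M̃_k, and stability; iterates u^{ν+1/2} = (M_m ∘ ⋯ ∘ M₁)(u^ν), u^{ν+1} = C(u^{ν+1/2})), assume additionally that the subspace decomposition ℝⁿ = Σ_{k=1}^m V_k is compatible with J. Then every accumulation point of the sequence (u^ν) is a global minimizer of J. -/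
open Filter Topology

/-- Coercive functions have relatively compact strict sublevel sets. -/
theorem exists_isCompact_of_coercive {E : Type*} [NormedAddCommGroup E] [ProperSpace E]
    {J : E → EReal}
    (hcoercive : ∀ c : ℝ, ∃ r : ℝ, ∀ x : E, r ≤ ‖x‖ → (c : EReal) ≤ J x)
    {a : EReal} (ha : a ≠ ⊤) : ∃ K : Set E, IsCompact K ∧ ∀ x, J x ≤ a → x ∈ K := by
  obtain ⟨c, hc, -⟩ := EReal.lt_iff_exists_real_btwn.1 ha.lt_top
  obtain ⟨r, hr⟩ := hcoercive c
  refine ⟨Metric.closedBall 0 r, isCompact_closedBall 0 r, fun x hx => ?_⟩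
  rw [mem_closedBall_zero_iff]
  by_contra! h
  exact absurd (hr x h.le) (hx.trans_lt hc).not_ge

/-- If `x` tends to a point `a` that is the only minimizer of `J` over `a + V`, and `y` stays in
a compact set with `y - x` in `V` and `J ∘ y ≤ J ∘ x`, then `y` tends to `a` as well. -/
theorem tendsto_of_sub_mem_of_unique_minimizer {ι E : Type*} [NormedAddCommGroup E]
    [NormedSpace ℝ E] [FiniteDimensional ℝ E] {l : Filter ι} {J : E → EReal}
    (hlsc : LowerSemicontinuous J) (V : Submodule ℝ E) {x y : ι → E} {a : E}
    (hx : Tendsto x l (𝓝 a)) (hJx : Tendsto (fun i => J (x i)) l (𝓝 (J a)))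
    (hyx : ∀ i, y i - x i ∈ V) (hJ : ∀ i, J (y i) ≤ J (x i))
    {K : Set E} (hK : IsCompact K) (hyK : ∀ i, y i ∈ K)
    (huniq : ∀ z, z - a ∈ V → J z ≤ J a → z = a) : Tendsto y l (𝓝 a) := by
  refine hK.tendsto_nhds_of_unique_mapClusterPt (.of_forall hyK) fun z _ hz => ?_
  obtain ⟨U, hUl, hUz⟩ := mapClusterPt_iff_ultrafilter.1 hz
  refine huniq z ?_ ?_
  · exact V.closed_of_finiteDimensional.mem_of_tendsto (hUz.sub (hx.mono_left hUl))
      (.of_forall hyx)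
  · by_contra! h
    obtain ⟨b, hab, hbz⟩ := exists_between h
    obtain ⟨i, hi, hi'⟩ := ((hUz.eventually (hlsc z b hbz)).and
      ((hJx.mono_left hUl).eventually (gt_mem_nhds hab))).exists
    exact absurd (hi.trans_le (hJ i)) hi'.not_gt

/-- Successive applications of energy-decreasing maps do not increase the energy. -/
theorem foldl_le_of_monotone {ι E : Type*} {J : E → EReal} {M : ι → E → E}
    (hM : ∀ k v, J v ≠ ⊤ → J (M k v) ≤ J v) (L : List ι) {v : E} (hv : J v ≠ ⊤) :
    J (L.foldl (fun w k => M k w) v) ≤ J v := by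
  induction L generalizing v with
  | nil => exact le_rfl
  | cons k L ih =>
    exact (ih (ne_top_of_le_ne_top hv (hM k v hv))).trans (hM k v hv)

/-- If a sequence of sweeps of subspace corrections starts at points converging to `a` and does
not decrease the energy below `J a`, then `a` is minimal in each of the visited subspaces. -/
theorem minimal_of_tendsto_of_le_foldl {ι κ E : Type*} [NormedAddCommGroup E]
    [NormedSpace ℝ E] [FiniteDimensional ℝ E] {l : Filter κ} [l.NeBot] {J : E → EReal}
    (hcoercive : ∀ c : ℝ, ∃ r : ℝ, ∀ x : E, r ≤ ‖x‖ → (c : EReal) ≤ J x)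
    (hlsc : LowerSemicontinuous J) (hcont : ContinuousOn J {x | J x ≠ ⊤})
    (V : ι → Submodule ℝ E)
    (huniq : ∀ w, J w ≠ ⊤ → ∀ k, ∃! z : E, z - w ∈ V k ∧ ∀ v ∈ V k, J z ≤ J (w + v))
    (M N : ι → E → E) (hMsub : ∀ k v, J v ≠ ⊤ → M k v - v ∈ V k)
    (hmono : ∀ k v, J v ≠ ⊤ → J (M k v) ≤ J (N k v) ∧ J (N k v) ≤ J v)
    (hNcont : ∀ k, ContinuousOn (fun v => J (N k v)) {x | J x ≠ ⊤})
    (hstable : ∀ k v, J v ≠ ⊤ → (∃ x ∈ V k, J (v + x) < J v) → J (N k v) < J v)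
    {a : E} (ha : J a ≠ ⊤) {b : EReal} (hb : b ≠ ⊤) (L : List ι) {x : κ → E}
    (hx : Tendsto x l (𝓝 a)) (hxb : ∀ i, J (x i) ≤ b)
    (hle : ∀ i, J a ≤ J (L.foldl (fun w k => M k w) (x i))) :
    ∀ k ∈ L, ∀ v ∈ V k, J a ≤ J (a + v) := by
  induction L generalizing x with
  | nil => simp
  | cons k L ih =>
    have hM : ∀ k v, J v ≠ ⊤ → J (M k v) ≤ J v := fun k v hv =>
      (hmono k v hv).1.trans (hmono k v hv).2
    have hxtop : ∀ i, J (x i) ≠ ⊤ := fun i => ne_top_of_le_ne_top hb (hxb i)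
    have hMb : ∀ i, J (M k (x i)) ≤ b := fun i => (hM k _ (hxtop i)).trans (hxb i)
    have hxdom : Tendsto x l (𝓝[{x | J x ≠ ⊤}] a) :=
      tendsto_nhdsWithin_iff.2 ⟨hx, .of_forall hxtop⟩
    have hNa : J a ≤ J (N k a) := ge_of_tendsto ((hNcont k a ha).tendsto.comp hxdom)
      (.of_forall fun i => (hle i).trans <|
        (foldl_le_of_monotone hM L (ne_top_of_le_ne_top hb (hMb i))).trans
          (hmono k _ (hxtop i)).1)
    have hmin : ∀ v ∈ V k, J a ≤ J (a + v) := by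
      intro v hv
      by_contra! h
      exact absurd (hstable k a ha ⟨v, hv, h⟩) hNa.not_gt
    obtain ⟨K, hK, hKmem⟩ := exists_isCompact_of_coercive hcoercive hb
    have hMx : Tendsto (fun i => M k (x i)) l (𝓝 a) :=
      tendsto_of_sub_mem_of_unique_minimizer hlsc (V k) hx ((hcont a ha).tendsto.comp hxdom)
        (fun i => hMsub k _ (hxtop i)) (fun i => hM k _ (hxtop i)) hK
        (fun i => hKmem _ (hMb i)) fun z hz hza =>
          (huniq a ha k).unique ⟨hz, fun v hv => hza.trans (hmin v hv)⟩ ⟨by simp, hmin⟩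
    exact List.forall_mem_cons.2 ⟨hmin, ih hMx hMb hle⟩

/-- **Global convergence of TNNMG (Theorem `thm:gs_stationary`).**
Let `J : ℝⁿ → ℝ ∪ {∞}` be coercive, proper, lower semicontinuous, continuous on its domain,
and such that `J (w + ·)` has a unique global minimizer in every subspace `V k` for every `w`
in the domain.  Given inexact local solvers `Mop k` (with corrections in `V k`), a correction
operator `C`, bounding operators `Mt k` satisfying monotonicity, continuity of `J ∘ Mt k`, and
stability, the TNNMG sequence `u (ν+1) = C ((Mop m ∘ ⋯ ∘ Mop 1) (u ν))` has only stationary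
accumulation points; if moreover the subspace decomposition is compatible with `J`, then
every accumulation point `ubar` of the sequence is a global minimizer of `J`
(Corollary `cor:gs_accumulation_points`). -/
theorem tnnmg_accumulation_points_minimizers
    {n m : ℕ}
    (J : EuclideanSpace ℝ (Fin n) → EReal)
    (hproper : ∃ x, J x ≠ ⊤)
    (hnobot : ∀ x, J x ≠ ⊥)
    (hcoercive : ∀ c : ℝ, ∃ r : ℝ, ∀ x : EuclideanSpace ℝ (Fin n), r ≤ ‖x‖ → (c : EReal) ≤ J x)
    (hlsc : LowerSemicontinuous J)
    (hcont : ContinuousOn J {x | J x ≠ ⊤})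
    (V : Fin m → Submodule ℝ (EuclideanSpace ℝ (Fin n)))
    (huniq : ∀ w, J w ≠ ⊤ → ∀ k : Fin m,
      ∃! z : EuclideanSpace ℝ (Fin n), z - w ∈ V k ∧ ∀ v ∈ V k, J z ≤ J (w + v))
    (Mop Mt : Fin m → EuclideanSpace ℝ (Fin n) → EuclideanSpace ℝ (Fin n))
    (C : EuclideanSpace ℝ (Fin n) → EuclideanSpace ℝ (Fin n))
    (hMsub : ∀ (k : Fin m) v, J v ≠ ⊤ → Mop k v - v ∈ V k)
    (hMtsub : ∀ (k : Fin m) v, J v ≠ ⊤ → Mt k v - v ∈ V k)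
    (hmono : ∀ (k : Fin m) v, J v ≠ ⊤ → J (Mop k v) ≤ J (Mt k v) ∧ J (Mt k v) ≤ J v)
    (hCmono : ∀ v, J v ≠ ⊤ → J (C v) ≤ J v)
    (hMtcont : ∀ k : Fin m, ContinuousOn (fun v => J (Mt k v)) {x | J x ≠ ⊤})
    (hstable : ∀ (k : Fin m) v, J v ≠ ⊤ → (∃ x ∈ V k, J (v + x) < J v) → J (Mt k v) < J v)
    (hcompat : ∀ w : EuclideanSpace ℝ (Fin n),
      (∀ k : Fin m, ∀ v ∈ V k, J w ≤ J (w + v)) →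
      ∀ v : EuclideanSpace ℝ (Fin n), J w ≤ J (w + v))
    (u : ℕ → EuclideanSpace ℝ (Fin n))
    (hu0 : J (u 0) ≠ ⊤)
    (hiter : ∀ ν : ℕ,
      u (ν + 1) = C ((List.finRange m).foldl (fun w k => Mop k w) (u ν)))
    (ubar : EuclideanSpace ℝ (Fin n))
    (σ : ℕ → ℕ) (hσ : StrictMono σ)
    (hacc : Filter.Tendsto (u ∘ σ) Filter.atTop (nhds ubar)) :
    ∀ v : EuclideanSpace ℝ (Fin n), J ubar ≤ J v := by
  have hM : ∀ k v, J v ≠ ⊤ → J (Mop k v) ≤ J v := fun k v hv =>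
    (hmono k v hv).1.trans (hmono k v hv).2
  have hfold : ∀ {v}, J v ≠ ⊤ → J ((List.finRange m).foldl (fun w k => Mop k w) v) ≤ J v :=
    foldl_le_of_monotone hM (List.finRange m)
  have hstep : ∀ ν, J (u ν) ≠ ⊤ →
      J (u (ν + 1)) ≤ J ((List.finRange m).foldl (fun w k => Mop k w) (u ν)) := fun ν hν => by
    rw [hiter]
    exact hCmono _ (ne_top_of_le_ne_top hν (hfold hν))
  have hdom : ∀ ν, J (u ν) ≠ ⊤ := fun ν => by
    induction ν with
    | zero => exact hu0
    | succ ν ih => exact ne_top_of_le_ne_top ih ((hstep ν ih).trans (hfold ih))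
  have hanti : Antitone fun ν => J (u ν) :=
    antitone_nat_of_succ_le fun ν => (hstep ν (hdom ν)).trans (hfold (hdom ν))
  have hbar : J ubar ≤ J (u 0) :=
    (hlsc.isClosed_preimage (J (u 0))).mem_of_tendsto hacc
      (.of_forall fun i => hanti (Nat.zero_le (σ i)))
  have hbartop := ne_top_of_le_ne_top hu0 hbar
  have hlim : Tendsto (fun i => J (u (σ i))) atTop (𝓝 (J ubar)) :=
    (hcont ubar hbartop).tendsto.comp
      (tendsto_nhdsWithin_iff.2 ⟨hacc, .of_forall fun i => hdom (σ i)⟩)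
  have hlow : ∀ ν, J ubar ≤ J (u ν) := fun ν =>
    le_of_tendsto hlim ((eventually_ge_atTop ν).mono fun i hi => hanti (hi.trans (hσ.id_le i)))
  have hmin := minimal_of_tendsto_of_le_foldl hcoercive hlsc hcont V huniq Mop Mt hMsub hmono
    hMtcont hstable hbartop hu0 (List.finRange m) hacc (fun i => hanti (Nat.zero_le (σ i)))
    (fun i => (hlow _).trans (hstep (σ i) (hdom _)))
  intro v
  simpa using hcompat ubar (fun k => hmin k (List.mem_finRange k)) (v - ubar)
end

section
/- Let J : ℝⁿ → ℝ ∪ {+∞} be coercive, proper, lower semicontinuous, and continuous on its domain, and assume dom J is a (not necessarily closed) convex polyhedron. Let V be any subspace of ℝⁿ. Then the exact minimal-energy map w ↦ min_{v ∈ w + V} J(v) is continuous on dom J, and any exact minimization operator M^ex(w) ∈ argmin_{v ∈ w + V} J(v) satisfies the monotonicity, continuity, and stability assumptions of the TNNMG convergence theorem with M̃ = M^ex. -/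
open scoped RealInnerProductSpace

open scoped Pointwise in
/-- If the sublevel set `{J ≤ a}` is compact and `J` exceeds `a` on all of `w + V`, then the same
holds on `w' + V` for all `w'` close to `w`. -/
lemma eventually_forall_add_mem_lt {E : Type*} [NormedAddCommGroup E] [NormedSpace ℝ E]
    [FiniteDimensional ℝ E] {J : E → EReal} {a : EReal} (hK : IsCompact {x | J x ≤ a})
    (V : Submodule ℝ E) {w : E} (hw : ∀ v ∈ V, a < J (w + v)) :
    ∀ᶠ w' in nhds w, ∀ v ∈ V, a < J (w' + v) := by
  have hcl : IsClosed ((V : Set E) + {x | J x ≤ a}) :=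
    V.closed_of_finiteDimensional.add_right_of_isCompact hK
  have hmem : w ∉ (V : Set E) + {x | J x ≤ a} := by
    rintro ⟨v, hv, x, hx, rfl⟩
    have := hw (-v) (V.neg_mem hv)
    simp only [add_neg_cancel_comm] at this
    exact absurd hx (not_le.2 this)
  filter_upwards [hcl.isOpen_compl.mem_nhds hmem] with w' hw' v hv
  by_contra! h
  exact hw' ⟨-v, V.neg_mem hv, w' + v, h, by simp⟩

/-- Points `w`, `w'`, `y` of a polyhedron: the point `w' + (1 - t) • (y - w)` with
`t = K * ‖w' - w‖` stays in the polyhedron, provided that `K` is large compared with the slack of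
the constraints that are inactive at `w`, and `w'` is close to `w`. -/
lemma polyhedron_add_smul_sub_mem {E ι : Type*} [NormedAddCommGroup E] [InnerProductSpace ℝ E]
    {b : ι → E} {c : ι → ℝ} {strict : ι → Bool} {P : Set E}
    (hP : P = {x | ∀ i, if strict i then ⟪b i, x⟫ < c i else ⟪b i, x⟫ ≤ c i})
    {w w' y : E} (hw : w ∈ P) (hw' : w' ∈ P) (hy : y ∈ P) {K : ℝ}
    (hK : ∀ i, ⟪b i, w⟫ < c i → ‖b i‖ < K * (c i - ⟪b i, w⟫)) (ht : K * ‖w' - w‖ ≤ 1) :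
    w' + (1 - K * ‖w' - w‖) • (y - w) ∈ P := by
  rcases eq_or_ne w' w with rfl | hne
  · simpa using hy
  subst hP
  intro i
  have hle : ∀ x ∈ {x | ∀ i, if strict i then ⟪b i, x⟫ < c i else ⟪b i, x⟫ ≤ c i},
      ⟪b i, x⟫ ≤ c i := fun x hx => by
    have := hx i
    split_ifs at this
    exacts [this.le, this]
  have hyi := hle y hy
  have hwi' := hle w' hw'
  have hexp : ⟪b i, w' + (1 - K * ‖w' - w‖) • (y - w)⟫ =
      ⟪b i, w'⟫ + (1 - K * ‖w' - w‖) * (⟪b i, y⟫ - ⟪b i, w⟫) := by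
    rw [inner_add_right, real_inner_smul_right, inner_sub_right]
  rcases (hle w hw).lt_or_eq with hlt | heq
  · have hd : 0 < ‖w' - w‖ := norm_pos_iff.2 (sub_ne_zero.2 hne)
    have h1 : ⟪b i, w'⟫ - ⟪b i, w⟫ ≤ ‖b i‖ * ‖w' - w‖ := by
      rw [← inner_sub_right]
      exact real_inner_le_norm _ _
    have h2 := mul_lt_mul_of_pos_right (hK i hlt) hd
    have h3 := mul_le_mul_of_nonneg_left hyi (sub_nonneg.2 ht)
    have h4 : ⟪b i, w' + (1 - K * ‖w' - w‖) • (y - w)⟫ < c i := by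
      rw [hexp]
      linarith
    split_ifs
    exacts [h4, h4.le]
  · have hs : ¬ strict i := fun hs => by
      have := hw i
      rw [if_pos hs] at this
      exact this.ne heq
    rw [if_neg hs, hexp, heq]
    linarith [mul_nonneg (sub_nonneg.2 ht) (sub_nonneg.2 hyi)]

/-- **Exact minimization with polyhedral domain (Lemma `lem:polyhedron_exact_minimization`).**
Let `J` be coercive, proper, lower semicontinuous, and continuous on its domain, and assume
that `dom J` is a (not necessarily closed) convex polyhedron, i.e. an intersection of finitely
many open or closed half-spaces.  Let `V` be any subspace of `ℝⁿ`.  Then the exact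
minimal-energy map `w ↦ min_{v ∈ w + V} J v = J (Mex w)` is continuous on `dom J`, and any
exact minimization operator `Mex` satisfies the monotonicity, continuity, and stability
assumptions of the TNNMG convergence theorem (with `M̃ = Mex`). -/
theorem exact_minimization_polyhedral_domain
    {n k : ℕ}
    (J : EuclideanSpace ℝ (Fin n) → EReal)
    (hproper : ∃ x, J x ≠ ⊤)
    (hnobot : ∀ x, J x ≠ ⊥)
    (hcoercive : ∀ c : ℝ, ∃ r : ℝ, ∀ x : EuclideanSpace ℝ (Fin n), r ≤ ‖x‖ → (c : EReal) ≤ J x)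
    (hlsc : LowerSemicontinuous J)
    (hcont : ContinuousOn J {x | J x ≠ ⊤})
    (b : Fin k → EuclideanSpace ℝ (Fin n)) (c : Fin k → ℝ) (strict : Fin k → Bool)
    (hdom : {x | J x ≠ ⊤} =
      {x : EuclideanSpace ℝ (Fin n) | ∀ i : Fin k,
        if strict i then ⟪b i, x⟫ < c i else ⟪b i, x⟫ ≤ c i})
    (V : Submodule ℝ (EuclideanSpace ℝ (Fin n)))
    (Mex : EuclideanSpace ℝ (Fin n) → EuclideanSpace ℝ (Fin n))
    (hMex : ∀ w, J w ≠ ⊤ → Mex w - w ∈ V ∧ ∀ v ∈ V, J (Mex w) ≤ J (w + v)) :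
    ContinuousOn (fun w => J (Mex w)) {w | J w ≠ ⊤} ∧
    (∀ w, J w ≠ ⊤ → J (Mex w) ≤ J w) ∧
    (∀ w, J w ≠ ⊤ → (∃ v ∈ V, J (w + v) < J w) → J (Mex w) < J w) := by
  have hmono : ∀ w, J w ≠ ⊤ → J (Mex w) ≤ J w := fun w hw => by
    simpa using (hMex w hw).2 0 V.zero_mem
  refine ⟨fun w hw => ?_, hmono, fun w hw ⟨v, hv, hlt⟩ => ((hMex w hw).2 v hv).trans_lt hlt⟩
  have hy : J (Mex w) ≠ ⊤ := ((hmono w hw).trans_lt (lt_top_iff_ne_top.2 hw)).ne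
  refine tendsto_order.2 ⟨fun a ha => ?_, fun a ha => ?_⟩
  · obtain ⟨r, har, -⟩ := EReal.lt_iff_exists_real_btwn.1 (ha.trans (lt_top_iff_ne_top.2 hy))
    obtain ⟨R, hR⟩ := hcoercive r
    have hK : IsCompact {x | J x ≤ a} := by
      refine Metric.isCompact_of_isClosed_isBounded (hlsc.isClosed_preimage a)
        (Metric.isBounded_closedBall.subset (t := Metric.closedBall 0 R) fun x hx => ?_)
      rw [mem_closedBall_zero_iff]
      by_contra! h
      exact absurd (hR x h.le) (not_le.2 (lt_of_le_of_lt hx har))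
    filter_upwards [self_mem_nhdsWithin, nhdsWithin_le_nhds (eventually_forall_add_mem_lt hK V
      fun v hv => ha.trans_le ((hMex w hw).2 v hv))] with w' hw' h
    simpa using h _ (hMex w' hw').1
  · obtain ⟨K, hK⟩ : ∃ K : ℝ, ∀ i, ⟪b i, w⟫ < c i → ‖b i‖ < K * (c i - ⟪b i, w⟫) := by
      refine (Filter.eventually_all (l := Filter.atTop).2 fun i => ?_).exists
      by_cases h : ⟪b i, w⟫ < c i
      · filter_upwards [(Filter.tendsto_id.atTop_mul_const (sub_pos.2 h)).eventually_gt_atTop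
          ‖b i‖] with K hK _ using hK
      · exact Filter.Eventually.of_forall fun K hlt => absurd hlt h
    let φ := fun w' : EuclideanSpace ℝ (Fin n) => w' + (1 - K * ‖w' - w‖) • (Mex w - w)
    have hφ : Continuous φ := by fun_prop
    have hφw : φ w = Mex w := by simp [φ]
    have ht : ∀ᶠ w' in nhds w, K * ‖w' - w‖ < 1 :=
      (show Continuous fun w' => K * ‖w' - w‖ by fun_prop).tendsto w |>.eventually_lt_const
        (by simp)
    have hmem : ∀ᶠ w' in nhdsWithin w {w | J w ≠ ⊤}, φ w' ∈ {w | J w ≠ ⊤} := by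
      filter_upwards [self_mem_nhdsWithin, nhdsWithin_le_nhds ht] with w' hw' ht'
      exact polyhedron_add_smul_sub_mem hdom hw hw' hy hK ht'.le
    have hlim : Filter.Tendsto φ (nhdsWithin w {w | J w ≠ ⊤})
        (nhdsWithin (Mex w) {w | J w ≠ ⊤}) :=
      tendsto_nhdsWithin_iff.2 ⟨hφw ▸ (hφ.tendsto w).mono_left nhdsWithin_le_nhds, hmem⟩
    filter_upwards [self_mem_nhdsWithin,
      ((hcont (Mex w) hy).tendsto.comp hlim).eventually_lt_const ha] with w' hw' h
    exact ((hMex w' hw').2 _ (V.smul_mem _ (hMex w hw).1)).trans_lt h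
end

section
/- Let f : ℝᴺ → ℝ ∪ {+∞} be convex with f = f₀ + ψ, where f₀ : ℝᴺ → ℝ is continuously differentiable and ψ : ℝᴺ → ℝ ∪ {+∞} is convex, proper, lower semicontinuous, and 0 ∈ dom ψ. Let M be a first-order model of f at 0, i.e. M(v) = f₀(0) + ⟨f₀'(0), v⟩ + M₀(v) + ψ(v) with M₀ : ℝᴺ → ℝ continuously differentiable, M₀(0) = 0 and M₀'(0) = 0. If v ∈ ℝᴺ satisfies f(v) < f(0), then there exists t > 0 such that M(tv) < M(0) = f(0). -/
open Filter Topology in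
/-- A function with zero derivative at the origin is eventually small along every ray. -/
theorem exists_ray_lt_of_hasFDerivAt_zero {E : Type*} [NormedAddCommGroup E] [NormedSpace ℝ E]
    {g : E → ℝ} (hg : HasFDerivAt g (0 : E →L[ℝ] ℝ) 0) (hg0 : g 0 = 0) (v : E) {d : ℝ}
    (hd : 0 < d) : ∃ t : ℝ, 0 < t ∧ t ≤ 1 ∧ g (t • v) < t * d := by
  have hline : HasDerivAt (fun t : ℝ => t • v) v 0 := by
    simpa using (hasDerivAt_id (0 : ℝ)).smul_const v
  have hG : HasDerivAt (fun t : ℝ => g (t • v)) 0 0 := by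
    have hg' : HasFDerivAt g (0 : E →L[ℝ] ℝ) ((0 : ℝ) • v) := by simpa using hg
    simpa [Function.comp_def] using hg'.comp_hasDerivAt (0 : ℝ) hline
  have hsmall := (hasDerivAt_iff_isLittleO.mp hG).def (half_pos hd)
  have hIoc : ∀ᶠ t : ℝ in 𝓝[>] 0, t ∈ Set.Ioc (0 : ℝ) 1 := Ioc_mem_nhdsGT one_pos
  obtain ⟨t, ht, ht0, ht1⟩ := ((hsmall.filter_mono nhdsWithin_le_nhds).and hIoc).exists
  refine ⟨t, ht0, ht1, ?_⟩
  simp only [zero_smul, hg0, sub_zero, smul_zero, Real.norm_eq_abs, abs_of_pos ht0] at ht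
  nlinarith [le_abs_self (g (t • v)), mul_pos ht0 hd]

/-- **First-order models detect descent (Lemma `lem:model_decrease`).**
Let `f = f₀ + ψ` be convex with `f₀` continuously differentiable and `ψ` convex, proper, lower
semicontinuous, `0 ∈ dom ψ`.  Let `Mmod` be a first-order model of `f` at `0`, i.e.
`Mmod v = f₀ 0 + ⟨f₀' 0, v⟩ + M₀ v + ψ v` with `M₀` continuously differentiable, `M₀ 0 = 0`,
`M₀' 0 = 0`.  If `f v < f 0`, then `Mmod 0 = f 0` and there exists `t > 0` with
`Mmod (t • v) < Mmod 0`. -/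
theorem first_order_model_decrease
    {N : ℕ}
    (f₀ M₀ : EuclideanSpace ℝ (Fin N) → ℝ)
    (ψ f Mmod : EuclideanSpace ℝ (Fin N) → EReal)
    (hf₀ : ContDiff ℝ 1 f₀)
    (hψconv : ∀ (x y : EuclideanSpace ℝ (Fin N)) (a b : ℝ), 0 ≤ a → 0 ≤ b → a + b = 1 →
      ψ (a • x + b • y) ≤ (a : EReal) * ψ x + (b : EReal) * ψ y)
    (hψproper : ∃ x, ψ x ≠ ⊤)
    (hψnobot : ∀ x, ψ x ≠ ⊥)
    (hψlsc : LowerSemicontinuous ψ)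
    (hψ0 : ψ 0 ≠ ⊤)
    (hfdef : ∀ v, f v = (f₀ v : EReal) + ψ v)
    (hfconv : ∀ (x y : EuclideanSpace ℝ (Fin N)) (a b : ℝ), 0 ≤ a → 0 ≤ b → a + b = 1 →
      f (a • x + b • y) ≤ (a : EReal) * f x + (b : EReal) * f y)
    (hM₀ : ContDiff ℝ 1 M₀)
    (hM₀0 : M₀ 0 = 0)
    (hM₀'0 : fderiv ℝ M₀ 0 = 0)
    (hMdef : ∀ v, Mmod v =
      ((f₀ 0 : ℝ) : EReal) + ((fderiv ℝ f₀ 0 v : ℝ) : EReal) + (M₀ v : EReal) + ψ v)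
    (v : EuclideanSpace ℝ (Fin N))
    (hv : f v < f 0) :
    Mmod 0 = f 0 ∧ ∃ t : ℝ, 0 < t ∧ Mmod (t • v) < Mmod 0 := by
  have hM0 : Mmod 0 = f 0 := by simp [hMdef, hfdef, hM₀0]
  refine ⟨hM0, ?_⟩
  have hψv : ψ v ≠ ⊤ := by
    intro h
    rw [hfdef v, h, EReal.coe_add_top] at hv
    exact not_top_lt hv
  obtain ⟨p, hp⟩ : ∃ p : ℝ, ψ v = p := ⟨_, (EReal.coe_toReal hψv (hψnobot v)).symm⟩
  obtain ⟨q, hq⟩ : ∃ q : ℝ, ψ 0 = q := ⟨_, (EReal.coe_toReal hψ0 (hψnobot 0)).symm⟩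
  have hd : 0 < (f₀ 0 + q) - (f₀ v + p) := by
    rw [hfdef, hfdef, hp, hq] at hv
    norm_cast at hv
    linarith
  have hf₀' : HasFDerivAt f₀ (fderiv ℝ f₀ 0) 0 :=
    (hf₀.differentiable one_ne_zero 0).hasFDerivAt
  have hM₀' : HasFDerivAt M₀ (0 : EuclideanSpace ℝ (Fin N) →L[ℝ] ℝ) 0 :=
    hM₀'0 ▸ (hM₀.differentiable one_ne_zero 0).hasFDerivAt
  have hg : HasFDerivAt (fun w => f₀ 0 + fderiv ℝ f₀ 0 w + M₀ w - f₀ w)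
      (0 : EuclideanSpace ℝ (Fin N) →L[ℝ] ℝ) 0 := by
    simpa using (((fderiv ℝ f₀ 0).hasFDerivAt.const_add (f₀ 0)).fun_add hM₀').fun_sub hf₀'
  obtain ⟨t, ht0, ht1, ht⟩ := exists_ray_lt_of_hasFDerivAt_zero hg (by simp [hM₀0]) v hd
  have hconv := hfconv v 0 t (1 - t) ht0.le (by linarith) (by ring)
  rw [smul_zero, add_zero, hfdef, hfdef v, hfdef 0, hp, hq] at hconv
  have hψt : ψ (t • v) ≠ ⊤ := by
    intro h
    rw [h, EReal.coe_add_top, top_le_iff] at hconv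
    norm_cast at hconv
    exact EReal.coe_ne_top _ hconv
  obtain ⟨r, hr⟩ : ∃ r : ℝ, ψ (t • v) = r := ⟨_, (EReal.coe_toReal hψt (hψnobot _)).symm⟩
  refine ⟨t, ht0, ?_⟩
  rw [hM0, hMdef, hfdef, hr, hq]
  rw [hr] at hconv
  norm_cast at hconv ⊢
  linarith
end

section
/- Let ψ : ℝᴺ → ℝ ∪ {+∞} be convex, proper, and lower semicontinuous, and let M₀ : ℝᴺ → ℝ be continuously differentiable with uniformly monotone derivative: there exist α > 0 and p > 1 such that α‖u − v‖^p ≤ ⟨M₀'(u) − M₀'(v), u − v⟩ for all u, v ∈ ℝᴺ. For g ∈ ℝᴺ let v_g denote a minimizer of v ↦ ⟨g, v⟩ + M₀(v) + ψ(v) over ℝᴺ. Then for any g₁, g₂ ∈ ℝᴺ for which minimizers v₁ = v_{g₁}, v₂ = v_{g₂} exist, one has α‖v₁ − v₂‖^{p−1} ≤ ‖g₁ − g₂‖; in particular the minimizer is unique and depends continuously (indeed Hölder continuously with exponent 1/(p−1)) on g. -/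
open scoped RealInnerProductSpace

/-- First-order optimality along a segment: if `v` minimizes `⟪g, ·⟫ + M + ψ` and `ψ` is finite at
`v` and `w`, then the variational inequality holds at `v` in the direction of `w`. -/
theorem variational_inequality_of_minimizer
    {E : Type*} [NormedAddCommGroup E] [InnerProductSpace ℝ E] [CompleteSpace E]
    {ψ : E → EReal} {M : E → ℝ} {g v w : E} {a b : ℝ}
    (hψ : ∀ (x y : E) (s t : ℝ), 0 ≤ s → 0 ≤ t → s + t = 1 →
      ψ (s • x + t • y) ≤ (s : EReal) * ψ x + (t : EReal) * ψ y)
    (hM : DifferentiableAt ℝ M v) (ha : ψ v = a) (hb : ψ w = b)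
    (hv : ∀ x : E, ((⟪g, v⟫ : ℝ) : EReal) + (M v : EReal) + ψ v ≤
      ((⟪g, x⟫ : ℝ) : EReal) + (M x : EReal) + ψ x) :
    0 ≤ ⟪gradient M v + g, w - v⟫ + b - a := by
  have hline : HasDerivAt (fun t : ℝ => v + t • (w - v)) (w - v) 0 := by
    simpa using ((hasDerivAt_id (0 : ℝ)).smul_const (w - v)).const_add v
  have hcomp : HasDerivAt (fun t : ℝ => M (v + t • (w - v))) ⟪gradient M v, w - v⟫ 0 := by
    have h := hM.hasGradientAt.hasFDerivAt
    rw [show v = v + (0 : ℝ) • (w - v) by simp] at h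
    simpa [Function.comp_def] using h.comp_hasDerivAt (0 : ℝ) hline
  have hderiv : HasDerivAt
      (fun t : ℝ => M (v + t • (w - v)) + t * (⟪g, w - v⟫ + b - a))
      (⟪gradient M v, w - v⟫ + (⟪g, w - v⟫ + b - a)) 0 := by
    simpa using hcomp.fun_add ((hasDerivAt_id (0 : ℝ)).mul_const (⟪g, w - v⟫ + b - a))
  have hnonneg := ge_of_tendsto (b := 0) hderiv.tendsto_slope_zero_right (by
    filter_upwards [Ioc_mem_nhdsGT (zero_lt_one (α := ℝ))] with t ht
    have hconv := hψ v w (1 - t) t (by linarith [ht.2]) ht.1.le (by ring)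
    rw [show (1 - t) • v + t • w = v + t • (w - v) by module, ha, hb] at hconv
    have hmin := (hv (v + t • (w - v))).trans (add_le_add_right hconv _)
    rw [ha] at hmin
    norm_cast at hmin
    rw [inner_add_right, inner_smul_right] at hmin
    simp only [zero_add, zero_smul, add_zero, zero_mul, smul_eq_mul]
    exact mul_nonneg (inv_nonneg.2 ht.1.le) (by linarith))
  rw [inner_add_left]
  linarith

/-- A minimizer of `f + ψ` with `f` real-valued and `ψ` proper has finite `ψ`-value. -/
theorem exists_real_eq_of_minimizer {X : Type*} {ψ : X → EReal} {f h : X → ℝ} {v : X}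
    (hproper : ∃ x, ψ x ≠ ⊤) (hnobot : ∀ x, ψ x ≠ ⊥)
    (hv : ∀ x, (f v : EReal) + (h v : EReal) + ψ v ≤ (f x : EReal) + (h x : EReal) + ψ x) :
    ∃ a : ℝ, ψ v = a := by
  obtain ⟨x, hx⟩ := hproper
  refine ⟨(ψ v).toReal, (EReal.coe_toReal (fun htop => ?_) (hnobot v)).symm⟩
  have hle := hv x
  rw [htop, ← EReal.coe_toReal hx (hnobot x), ← EReal.coe_add, ← EReal.coe_add, ← EReal.coe_add,
    EReal.coe_add_top, top_le_iff] at hle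
  exact EReal.coe_ne_top _ hle

/-- **Continuous dependence of model minimizers (core estimate of the theorem on first-order
dominating models).**  Let `ψ` be convex, proper, lower semicontinuous, and let `M₀` be
continuously differentiable with uniformly monotone derivative:
`α ‖u − v‖ᵖ ≤ ⟨M₀' u − M₀' v, u − v⟩` with `α > 0`, `p > 1`.  If `v₁`, `v₂` minimize
`v ↦ ⟨g₁, v⟩ + M₀ v + ψ v` and `v ↦ ⟨g₂, v⟩ + M₀ v + ψ v` respectively, then
`α ‖v₁ − v₂‖^(p−1) ≤ ‖g₁ − g₂‖`; in particular the minimizer is unique and depends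
continuously on `g`. -/
theorem model_minimizer_continuous_dependence
    {N : ℕ}
    (ψ : EuclideanSpace ℝ (Fin N) → EReal)
    (hψconv : ∀ (x y : EuclideanSpace ℝ (Fin N)) (a b : ℝ), 0 ≤ a → 0 ≤ b → a + b = 1 →
      ψ (a • x + b • y) ≤ (a : EReal) * ψ x + (b : EReal) * ψ y)
    (hψproper : ∃ x, ψ x ≠ ⊤)
    (hψnobot : ∀ x, ψ x ≠ ⊥)
    (hψlsc : LowerSemicontinuous ψ)
    (M₀ : EuclideanSpace ℝ (Fin N) → ℝ)
    (hM₀ : ContDiff ℝ 1 M₀)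
    (α p : ℝ) (hα : 0 < α) (hp : 1 < p)
    (hmono : ∀ u v : EuclideanSpace ℝ (Fin N),
      α * ‖u - v‖ ^ p ≤ ⟪gradient M₀ u - gradient M₀ v, u - v⟫)
    (g₁ g₂ v₁ v₂ : EuclideanSpace ℝ (Fin N))
    (hv₁ : ∀ v : EuclideanSpace ℝ (Fin N),
      ((⟪g₁, v₁⟫ : ℝ) : EReal) + (M₀ v₁ : EReal) + ψ v₁ ≤
        ((⟪g₁, v⟫ : ℝ) : EReal) + (M₀ v : EReal) + ψ v)
    (hv₂ : ∀ v : EuclideanSpace ℝ (Fin N),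
      ((⟪g₂, v₂⟫ : ℝ) : EReal) + (M₀ v₂ : EReal) + ψ v₂ ≤
        ((⟪g₂, v⟫ : ℝ) : EReal) + (M₀ v : EReal) + ψ v) :
    α * ‖v₁ - v₂‖ ^ (p - 1) ≤ ‖g₁ - g₂‖ ∧ (g₁ = g₂ → v₁ = v₂) := by
  obtain ⟨a₁, ha₁⟩ := exists_real_eq_of_minimizer (f := fun v => ⟪g₁, v⟫) hψproper hψnobot hv₁
  obtain ⟨a₂, ha₂⟩ := exists_real_eq_of_minimizer (f := fun v => ⟪g₂, v⟫) hψproper hψnobot hv₂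
  have hdiff := hM₀.differentiable one_ne_zero
  have h₁ := variational_inequality_of_minimizer hψconv (hdiff v₁) ha₁ ha₂ hv₁
  have h₂ := variational_inequality_of_minimizer hψconv (hdiff v₂) ha₂ ha₁ hv₂
  have hcs := real_inner_le_norm (g₂ - g₁) (v₁ - v₂)
  have hm := hmono v₁ v₂
  have hpow : α * ‖v₁ - v₂‖ ^ p ≤ ‖g₁ - g₂‖ * ‖v₁ - v₂‖ := by
    rw [norm_sub_rev g₁ g₂]
    simp only [inner_add_left, inner_sub_left, inner_sub_right] at h₁ h₂ hcs hm
    linarith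
  have hbound : α * ‖v₁ - v₂‖ ^ (p - 1) ≤ ‖g₁ - g₂‖ := by
    rcases (norm_nonneg (v₁ - v₂)).eq_or_lt with h0 | hpos
    · rw [← h0, Real.zero_rpow (by linarith), mul_zero]
      exact norm_nonneg _
    · refine le_of_mul_le_mul_right ?_ hpos
      rwa [mul_assoc, ← Real.rpow_add_one hpos.ne', sub_add_cancel]
  refine ⟨hbound, fun hg => ?_⟩
  by_contra hne
  have hpos : 0 < ‖v₁ - v₂‖ := norm_pos_iff.2 (sub_ne_zero.2 hne)
  rw [hg, sub_self, norm_zero] at hbound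
  exact absurd hbound (not_le.2 (by positivity))
end

section
/- Let f = f₀ + ψ with f₀ : ℝᴺ → ℝ continuously differentiable and ψ : ℝᴺ → ℝ ∪ {+∞} convex, proper, lower semicontinuous, 0 ∈ dom ψ, and let M(v) = f₀(0) + ⟨f₀'(0), v⟩ + M₀(v) + ψ(v) be a first-order model of f at 0 (M₀ continuously differentiable, M₀(0) = 0, M₀'(0) = 0). If ⟨f₀'(v) − f₀'(0), v⟩ ≤ ⟨M₀'(v) − M₀'(0), v⟩ for all v ∈ ℝᴺ, then M is dominating, i.e. M(v) ≥ f(v) for all v ∈ ℝᴺ. -/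
open scoped RealInnerProductSpace

/-- A differentiable function whose radial derivative is nonnegative is minimal at the origin. -/
theorem apply_zero_le_of_fderiv_apply_self_nonneg {E : Type*} [NormedAddCommGroup E]
    [NormedSpace ℝ E] {g : E → ℝ} (hg : Differentiable ℝ g) (h : ∀ w, 0 ≤ fderiv ℝ g w w)
    (v : E) : g 0 ≤ g v := by
  have hderiv (t : ℝ) : HasDerivAt (fun t : ℝ => g (t • v)) (fderiv ℝ g (t • v) v) t := by
    have hline : HasDerivAt (fun t : ℝ => t • v) v t := by
      simpa using (hasDerivAt_id t).smul_const v
    exact (hg (t • v)).hasFDerivAt.comp_hasDerivAt t hline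
  have hmono : MonotoneOn (fun t : ℝ => g (t • v)) (Set.Icc 0 1) := by
    refine monotoneOn_of_deriv_nonneg (convex_Icc 0 1)
      (fun t _ => (hderiv t).continuousAt.continuousWithinAt)
      (fun t _ => (hderiv t).differentiableAt.differentiableWithinAt) fun t ht => ?_
    rw [interior_Icc] at ht
    rw [(hderiv t).deriv]
    have ht' := h (t • v)
    rw [map_smul, smul_eq_mul] at ht'
    exact nonneg_of_mul_nonneg_right ht' ht.1
  simpa using hmono (Set.left_mem_Icc.2 zero_le_one) (Set.right_mem_Icc.2 zero_le_one) zero_le_one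

/-- **A sufficient condition for dominating models (Lemma `lemma:dominating`).**
Let `Mmod` be a first-order model of `f = f₀ + ψ` at `0`, i.e.
`Mmod v = f₀ 0 + ⟨f₀' 0, v⟩ + M₀ v + ψ v` with `M₀` continuously differentiable, `M₀ 0 = 0`,
`M₀' 0 = 0`.  If `⟨f₀' v − f₀' 0, v⟩ ≤ ⟨M₀' v − M₀' 0, v⟩` for all `v`, then `Mmod` is
dominating: `Mmod v ≥ f v` for all `v`. -/
theorem first_order_model_dominating
    {N : ℕ}
    (f₀ M₀ : EuclideanSpace ℝ (Fin N) → ℝ)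
    (ψ f Mmod : EuclideanSpace ℝ (Fin N) → EReal)
    (hf₀ : ContDiff ℝ 1 f₀)
    (hψconv : ∀ (x y : EuclideanSpace ℝ (Fin N)) (a b : ℝ), 0 ≤ a → 0 ≤ b → a + b = 1 →
      ψ (a • x + b • y) ≤ (a : EReal) * ψ x + (b : EReal) * ψ y)
    (hψproper : ∃ x, ψ x ≠ ⊤)
    (hψnobot : ∀ x, ψ x ≠ ⊥)
    (hψlsc : LowerSemicontinuous ψ)
    (hψ0 : ψ 0 ≠ ⊤)
    (hfdef : ∀ v, f v = (f₀ v : EReal) + ψ v)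
    (hM₀ : ContDiff ℝ 1 M₀)
    (hM₀0 : M₀ 0 = 0)
    (hM₀'0 : fderiv ℝ M₀ 0 = 0)
    (hMdef : ∀ v, Mmod v =
      ((f₀ 0 : ℝ) : EReal) + ((fderiv ℝ f₀ 0 v : ℝ) : EReal) + (M₀ v : EReal) + ψ v)
    (hbound : ∀ v : EuclideanSpace ℝ (Fin N),
      ⟪gradient f₀ v - gradient f₀ 0, v⟫ ≤ ⟪gradient M₀ v - gradient M₀ 0, v⟫) :
    ∀ v : EuclideanSpace ℝ (Fin N), f v ≤ Mmod v := by
  intro v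
  have hdf : Differentiable ℝ f₀ := hf₀.differentiable one_ne_zero
  have hdM : Differentiable ℝ M₀ := hM₀.differentiable one_ne_zero
  have hmin := apply_zero_le_of_fderiv_apply_self_nonneg (g := M₀ - f₀ + ⇑(fderiv ℝ f₀ 0))
    ((hdM.sub hdf).add (fderiv ℝ f₀ 0).differentiable) (fun w => by
      rw [(((hdM w).hasFDerivAt.sub (hdf w).hasFDerivAt).add
        (fderiv ℝ f₀ 0).hasFDerivAt).fderiv]
      have hw := hbound w
      simp only [gradient, ← map_sub, InnerProductSpace.toDual_symm_apply, hM₀'0] at hw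
      simp only [sub_apply, zero_apply,
        add_apply] at hw ⊢
      linarith) v
  simp only [Pi.add_apply, Pi.sub_apply, map_zero, hM₀0] at hmin
  rw [hfdef, hMdef]
  gcongr
  norm_cast
  linarith
end

section
/- Let F : ℝⁿ → ℝ ∪ {+∞} be coercive, lower semicontinuous, and continuous on its domain dom F = {x : F(x) < ∞}. Let 𝒱 = (V_x)_{x ∈ ℝⁿ} be a family of subspaces of ℝⁿ such that K = dom F is stable with respect to translations in 𝒱. Then the function m(x) := min_{v ∈ V_x} F(x + v) is well defined and continuous on dom F. -/
theorem isCompact_setOf_le_of_coercive {E : Type*} [NormedAddCommGroup E] [ProperSpace E]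
    {F : E → EReal} (hcoercive : ∀ c : ℝ, ∃ r : ℝ, ∀ x : E, r ≤ ‖x‖ → (c : EReal) ≤ F x)
    (hlsc : LowerSemicontinuous F) {c : EReal} (hc : c ≠ ⊤) : IsCompact {x | F x ≤ c} := by
  obtain ⟨q, hcq, -⟩ := EReal.lt_iff_exists_real_btwn.1 hc.lt_top
  obtain ⟨r, hr⟩ := hcoercive q
  refine (isCompact_closedBall (0 : E) r).of_isClosed_subset (hlsc.isClosed_preimage c) ?_
  intro x hx
  rw [mem_closedBall_zero_iff]
  by_contra! h
  exact absurd (hcq.trans_le (hr x h.le)) (not_lt.2 hx)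

theorem exists_iInf_eq_of_coercive {E : Type*} [NormedAddCommGroup E] [NormedSpace ℝ E]
    [FiniteDimensional ℝ E] {F : E → EReal}
    (hcoercive : ∀ c : ℝ, ∃ r : ℝ, ∀ x : E, r ≤ ‖x‖ → (c : EReal) ≤ F x)
    (hlsc : LowerSemicontinuous F) (W : Submodule ℝ E) {x : E} (hx : F x ≠ ⊤) :
    ∃ v ∈ W, (⨅ w ∈ W, F (x + w)) = F (x + v) := by
  have : ProperSpace E := FiniteDimensional.proper_real E
  have hK : IsCompact ((W : Set E) ∩ (fun w => x + w) ⁻¹' {y | F y ≤ F x}) :=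
    ((Homeomorph.addLeft x).isClosedEmbedding.isCompact_preimage
      (isCompact_setOf_le_of_coercive hcoercive hlsc hx)).inter_left W.closed_of_finiteDimensional
  have hl : LowerSemicontinuous fun w => F (x + w) :=
    hlsc.comp (continuous_const.add continuous_id)
  have hne : ((W : Set E) ∩ (fun w => x + w) ⁻¹' {y | F y ≤ F x}).Nonempty :=
    ⟨0, W.zero_mem, by simp⟩
  obtain ⟨v, ⟨hvW, hvx⟩, hmin⟩ :=
    LowerSemicontinuousOn.exists_isMinOn hne hK (hl.lowerSemicontinuousOn _)
  refine ⟨v, hvW, le_antisymm (iInf₂_le v hvW) (le_iInf₂ fun w hw => ?_)⟩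
  by_cases h : F (x + w) ≤ F x
  · exact hmin ⟨hw, h⟩
  · exact le_trans hvx (not_le.1 h).le

/-- **Continuity of minimization over stable families of subspaces (Theorem
`thm:min_continuity`).**  Let `F : ℝⁿ → ℝ ∪ {∞}` be coercive, lower semicontinuous, and
continuous on its domain `K = dom F`, and let `(V x)` be a family of subspaces such that `K`
is stable with respect to translations in the family.  Then
`m x = min_{v ∈ V x} F (x + v)` is well defined (the infimum is attained) and continuous on
`dom F`. -/
theorem min_over_stable_family_continuous
    {n : ℕ}
    (F : EuclideanSpace ℝ (Fin n) → EReal)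
    (hnobot : ∀ x, F x ≠ ⊥)
    (hcoercive : ∀ c : ℝ, ∃ r : ℝ, ∀ x : EuclideanSpace ℝ (Fin n), r ≤ ‖x‖ → (c : EReal) ≤ F x)
    (hlsc : LowerSemicontinuous F)
    (hcont : ContinuousOn F {x | F x ≠ ⊤})
    (V : EuclideanSpace ℝ (Fin n) → Submodule ℝ (EuclideanSpace ℝ (Fin n)))
    (hstable₁ : ∀ (x : EuclideanSpace ℝ (Fin n)) (xs : ℕ → EuclideanSpace ℝ (Fin n)),
      (∀ ν, F (xs ν) ≠ ⊤) → F x ≠ ⊤ → Filter.Tendsto xs Filter.atTop (nhds x) →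
      ∀ (vs : ℕ → EuclideanSpace ℝ (Fin n)) (v : EuclideanSpace ℝ (Fin n)),
        (∀ ν, vs ν ∈ V (xs ν)) → Filter.Tendsto vs Filter.atTop (nhds v) → v ∈ V x)
    (hstable₂ : ∀ (x : EuclideanSpace ℝ (Fin n)) (xs : ℕ → EuclideanSpace ℝ (Fin n)),
      (∀ ν, F (xs ν) ≠ ⊤) → F x ≠ ⊤ → Filter.Tendsto xs Filter.atTop (nhds x) →
      ∀ v ∈ V x, F (x + v) ≠ ⊤ →
        ∃ vs : ℕ → EuclideanSpace ℝ (Fin n),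
          (∀ ν, vs ν ∈ V (xs ν) ∧ F (xs ν + vs ν) ≠ ⊤) ∧
          Filter.Tendsto vs Filter.atTop (nhds v)) :
    (∀ x : EuclideanSpace ℝ (Fin n), F x ≠ ⊤ →
      ∃ v ∈ V x, (⨅ w ∈ V x, F (x + w)) = F (x + v)) ∧
    ContinuousOn (fun x => ⨅ w ∈ V x, F (x + w)) {x | F x ≠ ⊤} := by
  have hattain : ∀ x, F x ≠ ⊤ → ∃ v ∈ V x, (⨅ w ∈ V x, F (x + w)) = F (x + v) :=
    fun x hx => exists_iInf_eq_of_coercive hcoercive hlsc (V x) hx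
  have hle : ∀ x, (⨅ w ∈ V x, F (x + w)) ≤ F x := fun x =>
    (iInf₂_le 0 (V x).zero_mem).trans (by simp)
  refine ⟨hattain, fun x hx => tendsto_order.2 ⟨fun a ha => ?_, fun a ha => ?_⟩⟩
  · by_contra hev
    obtain ⟨xs, hxs, hprop⟩ := Filter.exists_seq_forall_of_frequently
      ((Filter.not_eventually.1 hev).and_eventually self_mem_nhdsWithin)
    have hxs' := hxs.mono_right nhdsWithin_le_nhds
    choose vs hvs hmin using fun ν => hattain (xs ν) (hprop ν).2
    have hbound : ∀ ν, F (xs ν + vs ν) ≤ a := fun ν => hmin ν ▸ not_lt.1 (hprop ν).1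
    obtain ⟨z, hz, φ, hφ, hlim⟩ := (isCompact_setOf_le_of_coercive hcoercive hlsc
      (ne_top_of_lt ha)).tendsto_subseq hbound
    have hxφ := hxs'.comp hφ.tendsto_atTop
    have hv : z - x ∈ V x := hstable₁ x (xs ∘ φ) (fun ν => (hprop (φ ν)).2) hx hxφ
      (vs ∘ φ) (z - x) (fun ν => hvs (φ ν)) ((hlim.sub hxφ).congr fun ν => by simp)
    have hmz : (⨅ w ∈ V x, F (x + w)) ≤ F z :=
      (iInf₂_le (z - x) hv).trans (by simp)
    exact absurd (ha.trans_le (hmz.trans hz)) (lt_irrefl a)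
  · by_contra hev
    obtain ⟨xs, hxs, hprop⟩ := Filter.exists_seq_forall_of_frequently
      ((Filter.not_eventually.1 hev).and_eventually self_mem_nhdsWithin)
    have hxs' := hxs.mono_right nhdsWithin_le_nhds
    obtain ⟨v, hv, hmin⟩ := hattain x hx
    have hvK : F (x + v) ≠ ⊤ := ne_top_of_le_ne_top hx (hmin ▸ hle x)
    obtain ⟨vs, hvs, hlim⟩ := hstable₂ x xs (fun ν => (hprop ν).2) hx hxs' v hv hvK
    have hF : Filter.Tendsto (fun ν => F (xs ν + vs ν)) Filter.atTop (nhds (F (x + v))) :=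
      (hcont (x + v) hvK).tendsto.comp (tendsto_nhdsWithin_iff.2
        ⟨hxs'.add hlim, Filter.Eventually.of_forall fun ν => (hvs ν).2⟩)
    obtain ⟨ν, hν⟩ := (hF.eventually_lt_const (hmin.symm.trans_lt ha)).exists
    exact (hprop ν).1 ((iInf₂_le (vs ν) (hvs ν).1).trans_lt hν)
end

section
/- Let F : ℝⁿ → ℝ ∪ {+∞} be coercive, lower semicontinuous, and continuous on its domain, and assume dom F = K₁ × K₂ is a product of sets K₁ ⊆ ℝ^{n₁} and K₂ ⊆ ℝ^{n₂} (with n = n₁ + n₂). Let V = ℝ^{n₁} × {0}. Then K₁ × K₂ is stable with respect to translations in the constant family (V)_{x ∈ ℝⁿ}, and the function m(x) := min_{v ∈ V} F(x + v) is continuous on dom F. -/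
open Filter Topology Set

section PartialMin

variable {X Y : Type*} [NormedAddCommGroup X] [ProperSpace X] [NormedAddCommGroup Y]

/-- The partial infimum of a coercive lower semicontinuous function is lower semicontinuous. -/
theorem lowerSemicontinuous_iInf_fst_of_coercive {F : X × Y → EReal}
    (hcoercive : ∀ c : ℝ, ∃ r : ℝ, ∀ x : X × Y, r ≤ ‖x‖ → (c : EReal) ≤ F x)
    (hlsc : LowerSemicontinuous F) :
    LowerSemicontinuous fun b => ⨅ y, F (y, b) := by
  intro b c hc
  obtain ⟨c', hcc', hc'⟩ := EReal.lt_iff_exists_real_btwn.1 hc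
  obtain ⟨r, hr⟩ := hcoercive c'
  have hnear : ∀ᶠ b' in 𝓝 b, ∀ y ∈ Metric.closedBall (0 : X) r, (c' : EReal) < F (y, b') := by
    refine (isCompact_closedBall (0 : X) r).eventually_forall_of_forall_eventually fun y _ => ?_
    exact (continuous_swap.tendsto (b, y)).eventually
      (hlsc (y, b) c' (hc'.trans_le (iInf_le _ y)))
  filter_upwards [hnear] with b' hb'
  refine hcc'.trans_le (le_iInf fun y => ?_)
  rcases le_total ‖y‖ r with hy | hy
  · exact (hb' y (by simpa using hy)).le
  · exact hr _ (hy.trans (norm_fst_le (y, b')))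

/-- The partial infimum of a coercive lower semicontinuous function is attained. -/
theorem exists_iInf_fst_eq_of_coercive {F : X × Y → EReal}
    (hcoercive : ∀ c : ℝ, ∃ r : ℝ, ∀ x : X × Y, r ≤ ‖x‖ → (c : EReal) ≤ F x)
    (hlsc : LowerSemicontinuous F) (b : Y) :
    ∃ y, ⨅ y', F (y', b) = F (y, b) := by
  by_cases htop : ∀ y, F (y, b) = ⊤
  · exact ⟨0, by simp [htop]⟩
  push Not at htop
  obtain ⟨a, ha⟩ := htop
  obtain ⟨c, hac, -⟩ := EReal.lt_iff_exists_real_btwn.1 (lt_top_iff_ne_top.2 ha)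
  obtain ⟨r, hr⟩ := hcoercive c
  have hball : ∀ y, r ≤ ‖y‖ → F (a, b) < F (y, b) := fun y hy =>
    hac.trans_le (hr _ (hy.trans (norm_fst_le (y, b))))
  have haball : a ∈ Metric.closedBall (0 : X) r := by
    by_contra h
    exact lt_irrefl _ (hball a (by simpa using (not_le.1 (by simpa using h)).le))
  have hlsc' : LowerSemicontinuous fun y => F (y, b) :=
    hlsc.comp (g := fun y : X => (y, b)) (by fun_prop)
  obtain ⟨y, -, hy⟩ := (hlsc'.lowerSemicontinuousOn _).exists_isMinOn ⟨a, haball⟩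
    (isCompact_closedBall (0 : X) r)
  refine ⟨y, le_antisymm (iInf_le _ y) (le_iInf fun y' => ?_)⟩
  rcases le_total ‖y'‖ r with h | h
  · exact hy (by simpa using h)
  · exact (hy haball).trans (hball y' h).le

/-- The partial minimum of a coercive lower semicontinuous function which is continuous on its
domain, a product set, is continuous on the second factor of that domain. -/
theorem continuousOn_iInf_fst_of_coercive {F : X × Y → EReal}
    (hcoercive : ∀ c : ℝ, ∃ r : ℝ, ∀ x : X × Y, r ≤ ‖x‖ → (c : EReal) ≤ F x)
    (hlsc : LowerSemicontinuous F) (hcont : ContinuousOn F {x | F x ≠ ⊤})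
    {K₁ : Set X} {K₂ : Set Y} (hdom : {x | F x ≠ ⊤} = K₁ ×ˢ K₂) :
    ContinuousOn (fun b => ⨅ y, F (y, b)) K₂ := by
  refine continuousOn_iff_lower_upperSemicontinuousOn.2
    ⟨(lowerSemicontinuous_iInf_fst_of_coercive hcoercive hlsc).lowerSemicontinuousOn _, ?_⟩
  intro b hb c hc
  obtain ⟨y, hy⟩ := exists_iInf_fst_eq_of_coercive hcoercive hlsc b
  have hyc : F (y, b) < c := hy ▸ hc
  have hyb : (y, b) ∈ K₁ ×ˢ K₂ := hdom ▸ hyc.ne_top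
  rw [hdom] at hcont
  have hslice : Tendsto (fun b' => (y, b')) (𝓝[K₂] b) (𝓝[K₁ ×ˢ K₂] (y, b)) :=
    ContinuousWithinAt.tendsto_nhdsWithin (by fun_prop) fun b' hb' => ⟨hyb.1, hb'⟩
  filter_upwards [((hcont _ hyb).tendsto.comp hslice).eventually_lt_const hyc] with b' hb'
  exact (iInf_le _ y).trans_lt hb'

end PartialMin

/-- **Continuity of partial minimization over product domains (Corollary
`cor:product_domain_continuity`).**  Let `F : ℝ^{n₁} × ℝ^{n₂} → ℝ ∪ {∞}` be coercive, lower
semicontinuous, and continuous on its domain, with `dom F = K₁ × K₂`, and let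
`V = ℝ^{n₁} × {0}`.  Then `dom F` is stable with respect to translations in the constant
family `V`, and `m x = min_{v ∈ V} F (x + v)` is attained and continuous on `dom F`. -/
theorem min_over_product_domain_continuous
    {n₁ n₂ : ℕ}
    (F : EuclideanSpace ℝ (Fin n₁) × EuclideanSpace ℝ (Fin n₂) → EReal)
    (hnobot : ∀ x, F x ≠ ⊥)
    (hcoercive : ∀ c : ℝ, ∃ r : ℝ,
      ∀ x : EuclideanSpace ℝ (Fin n₁) × EuclideanSpace ℝ (Fin n₂),
        r ≤ ‖x‖ → (c : EReal) ≤ F x)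
    (hlsc : LowerSemicontinuous F)
    (hcont : ContinuousOn F {x | F x ≠ ⊤})
    (K₁ : Set (EuclideanSpace ℝ (Fin n₁))) (K₂ : Set (EuclideanSpace ℝ (Fin n₂)))
    (hdom : {x | F x ≠ ⊤} = K₁ ×ˢ K₂)
    (V : Submodule ℝ (EuclideanSpace ℝ (Fin n₁) × EuclideanSpace ℝ (Fin n₂)))
    (hV : V = (⊤ : Submodule ℝ (EuclideanSpace ℝ (Fin n₁))).prod
      (⊥ : Submodule ℝ (EuclideanSpace ℝ (Fin n₂)))) :
    (∀ (x : EuclideanSpace ℝ (Fin n₁) × EuclideanSpace ℝ (Fin n₂))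
        (xs : ℕ → EuclideanSpace ℝ (Fin n₁) × EuclideanSpace ℝ (Fin n₂)),
      (∀ ν, F (xs ν) ≠ ⊤) → F x ≠ ⊤ → Filter.Tendsto xs Filter.atTop (nhds x) →
      (∀ (vs : ℕ → EuclideanSpace ℝ (Fin n₁) × EuclideanSpace ℝ (Fin n₂))
          (v : EuclideanSpace ℝ (Fin n₁) × EuclideanSpace ℝ (Fin n₂)),
        (∀ ν, vs ν ∈ V) → Filter.Tendsto vs Filter.atTop (nhds v) → v ∈ V) ∧
      (∀ v ∈ V, F (x + v) ≠ ⊤ →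
        ∃ vs : ℕ → EuclideanSpace ℝ (Fin n₁) × EuclideanSpace ℝ (Fin n₂),
          (∀ ν, vs ν ∈ V ∧ F (xs ν + vs ν) ≠ ⊤) ∧
          Filter.Tendsto vs Filter.atTop (nhds v))) ∧
    (∀ x, F x ≠ ⊤ → ∃ v ∈ V, (⨅ w ∈ V, F (x + w)) = F (x + v)) ∧
    ContinuousOn (fun x => ⨅ w ∈ V, F (x + w)) {x | F x ≠ ⊤} := by
  have hmem : ∀ v, v ∈ V ↔ v.2 = 0 := fun v => by simp [hV, Submodule.mem_prod]
  have hinf : ∀ x, ⨅ w ∈ V, F (x + w) = ⨅ y, F (y, x.2) := by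
    intro x
    refine le_antisymm (le_iInf fun y => ?_) (le_iInf₂ fun w hw => ?_)
    · refine (iInf₂_le (y - x.1, 0) ((hmem _).2 rfl)).trans_eq ?_
      congr 1
      ext1 <;> simp
    · refine (iInf_le _ (x.1 + w.1)).trans_eq ?_
      congr 1
      ext1 <;> simp [(hmem w).1 hw]
  have hdom' : ∀ x, F x ≠ ⊤ ↔ x.1 ∈ K₁ ∧ x.2 ∈ K₂ := fun x => Set.ext_iff.1 hdom x
  refine ⟨fun x xs hxs _ hlim => ⟨fun vs v hvs hv => ?_, fun v hv hxv => ?_⟩, fun x _ => ?_, ?_⟩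
  · exact V.closed_of_finiteDimensional.mem_of_tendsto hv (Eventually.of_forall hvs)
  · refine ⟨fun ν => (x.1 + v.1 - (xs ν).1, 0), fun ν => ⟨(hmem _).2 rfl, ?_⟩, ?_⟩
    · rw [hdom'] at hxv ⊢
      exact ⟨by simpa using hxv.1, by simpa using ((hdom' _).1 (hxs ν)).2⟩
    · have hfst : Tendsto (fun ν => x.1 + v.1 - (xs ν).1) atTop (𝓝 v.1) := by
        simpa using (tendsto_const_nhds (x := x.1 + v.1)).sub (hlim.fst_nhds)
      have hv2 : v = (v.1, 0) := Prod.ext rfl ((hmem v).1 hv)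
      rw [hv2]
      exact hfst.prodMk_nhds tendsto_const_nhds
  · obtain ⟨y, hy⟩ := exists_iInf_fst_eq_of_coercive hcoercive hlsc x.2
    refine ⟨(y - x.1, 0), (hmem _).2 rfl, ?_⟩
    rw [hinf, hy]
    congr 1
    ext1 <;> simp
  · simp only [hinf]
    exact (continuousOn_iInf_fst_of_coercive hcoercive hlsc hcont hdom).comp
      continuousOn_snd fun x hx => ((hdom' x).1 hx).2
end

section
/- Let F : ℝⁿ → ℝ ∪ {+∞} be coercive, lower semicontinuous, and continuous on its domain, and assume K = dom F is a (not necessarily closed) convex polyhedron, i.e. K = {x ∈ ℝⁿ : ⟨b_i, x⟩ ◁_i c_i, i = 1,…,k} where each ◁_i is either '<' or '≤'. Let V be any fixed subspace of ℝⁿ. Then K is stable with respect to translations in the constant family (V)_{x ∈ ℝⁿ}, and the function m(x) := min_{v ∈ V} F(x + v) is continuous on dom F. -/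
open scoped RealInnerProductSpace

/-- If `x` and `x + v` lie in a polyhedron, then every point `y` of the polyhedron can be translated
along `v`, staying in the polyhedron, by a factor depending continuously on `y` that is `1` at
`x`. -/
theorem exists_continuous_smul_translate_mem {E ι : Type*} [NormedAddCommGroup E]
    [InnerProductSpace ℝ E] [Fintype ι] (b : ι → E) (c : ι → ℝ) (strict : ι → Bool) {x v : E}
    (hxv : ∀ i, if strict i then ⟪b i, x + v⟫ < c i else ⟪b i, x + v⟫ ≤ c i) :
    ∃ t : E → ℝ, Continuous t ∧ t x = 1 ∧
      ∀ y, (∀ i, if strict i then ⟪b i, y⟫ < c i else ⟪b i, y⟫ ≤ c i) →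
        ∀ i, if strict i then ⟪b i, y + t y • v⟫ < c i else ⟪b i, y + t y • v⟫ ≤ c i := by
  set C : ℝ := ∑ i, ‖b i‖ / |⟪b i, v⟫| with hC
  refine ⟨fun y => max 0 (1 - C * ‖y - x‖), by fun_prop, by simp, fun y hy i => ?_⟩
  have hyi := hy i
  have hxi := hxv i
  have key : ⟪b i, y + max 0 (1 - C * ‖y - x‖) • v⟫ ≤ max ⟪b i, y⟫ ⟪b i, x + v⟫ := by
    rw [inner_add_right, inner_add_right, real_inner_smul_right]
    rcases le_or_gt ⟪b i, v⟫ 0 with ha | ha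
    · exact le_max_of_le_left
        (by linarith [mul_nonpos_of_nonneg_of_nonpos (le_max_left 0 (1 - C * ‖y - x‖)) ha])
    rcases le_total (1 - C * ‖y - x‖) 0 with h | h
    · rw [max_eq_left h]
      exact le_max_of_le_left (by simp)
    · rw [max_eq_right h]
      refine le_max_of_le_right ?_
      have hCi : ‖b i‖ / |⟪b i, v⟫| ≤ C :=
        Finset.single_le_sum (f := fun i => ‖b i‖ / |⟪b i, v⟫|)
          (fun j _ => by positivity) (Finset.mem_univ i)
      rw [abs_of_pos ha, div_le_iff₀ ha] at hCi
      have hin : ⟪b i, y⟫ - ⟪b i, x⟫ ≤ ‖b i‖ * ‖y - x‖ := by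
        rw [← inner_sub_right]
        exact real_inner_le_norm _ _
      nlinarith [mul_le_mul_of_nonneg_right hCi (norm_nonneg (y - x))]
  split_ifs at hyi hxi ⊢ with hs
  · exact key.trans_lt (max_lt hyi hxi)
  · exact key.trans (max_le hyi hxi)

/-- A coercive lower semicontinuous function attains its minimum on every translate of a subspace
through a point of its domain. -/
theorem exists_iInf_translate_eq {E : Type*} [NormedAddCommGroup E] [NormedSpace ℝ E]
    [FiniteDimensional ℝ E] {F : E → EReal} (hnobot : ∀ x, F x ≠ ⊥)
    (hcoercive : ∀ c : ℝ, ∃ r : ℝ, ∀ x, r ≤ ‖x‖ → (c : EReal) ≤ F x)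
    (hlsc : LowerSemicontinuous F) (V : Submodule ℝ E) {x : E} (hx : F x ≠ ⊤) :
    ∃ v ∈ V, (⨅ w ∈ V, F (x + w)) = F (x + v) := by
  obtain ⟨r, hr⟩ := hcoercive (F x).toReal
  rw [EReal.coe_toReal hx (hnobot x)] at hr
  have := FiniteDimensional.proper ℝ E
  have hcomp : IsCompact (Metric.closedBall (0 : E) (|r| + ‖x‖) ∩ V) :=
    (isCompact_closedBall _ _).inter_right V.closed_of_finiteDimensional
  have hlsc' : LowerSemicontinuous fun w => F (x + w) :=
    hlsc.comp (continuous_const.add continuous_id)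
  have h0 : (0 : E) ∈ Metric.closedBall (0 : E) (|r| + ‖x‖) ∩ V :=
    ⟨Metric.mem_closedBall_self (by positivity), V.zero_mem⟩
  obtain ⟨v, hv, hmin⟩ := (hlsc'.lowerSemicontinuousOn _).exists_isMinOn ⟨0, h0⟩ hcomp
  refine ⟨v, hv.2, le_antisymm (iInf₂_le v hv.2) (le_iInf₂ fun w hw => ?_)⟩
  by_cases hwr : ‖w‖ ≤ |r| + ‖x‖
  · exact hmin ⟨by simpa using hwr, hw⟩
  · have h1 : F (x + v) ≤ F x := by simpa using hmin h0
    refine h1.trans (hr _ ?_)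
    have h2 : ‖w‖ ≤ ‖x + w‖ + ‖x‖ := by simpa using norm_sub_le (x + w) x
    linarith [le_abs_self r]

/-- Minimizing a coercive lower semicontinuous function over translates of a subspace yields a
lower semicontinuous function. -/
theorem lowerSemicontinuous_iInf_translate {E : Type*} [NormedAddCommGroup E] [NormedSpace ℝ E]
    [FiniteDimensional ℝ E] {F : E → EReal}
    (hcoercive : ∀ c : ℝ, ∃ r : ℝ, ∀ x, r ≤ ‖x‖ → (c : EReal) ≤ F x)
    (hlsc : LowerSemicontinuous F) (V : Submodule ℝ E) :
    LowerSemicontinuous fun x => ⨅ w ∈ V, F (x + w) := by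
  intro x α hα
  obtain ⟨β, hαβ, hβ⟩ := EReal.lt_iff_exists_real_btwn.1 hα
  obtain ⟨r, hr⟩ := hcoercive β
  have := FiniteDimensional.proper ℝ E
  have hcomp : IsCompact (Metric.closedBall (0 : E) (r + ‖x‖ + 1) ∩ V) :=
    (isCompact_closedBall _ _).inter_right V.closed_of_finiteDimensional
  have hlsc' : LowerSemicontinuous fun p : E × E => F (p.1 + p.2) := hlsc.comp continuous_add
  have hev : ∀ᶠ y in nhds x, ∀ w ∈ Metric.closedBall (0 : E) (r + ‖x‖ + 1) ∩ V,
      (β : EReal) < F (y + w) :=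
    hcomp.eventually_forall_of_forall_eventually fun w hw =>
      hlsc' (x, w) β (hβ.trans_le (iInf₂_le w hw.2))
  filter_upwards [hev, Metric.ball_mem_nhds x one_pos] with y hy hyx
  refine hαβ.trans_le (le_iInf₂ fun w hw => ?_)
  by_cases hwr : ‖w‖ ≤ r + ‖x‖ + 1
  · exact (hy w ⟨by simpa using hwr, hw⟩).le
  · refine hr _ ?_
    have h1 : ‖w‖ ≤ ‖y + w‖ + ‖y‖ := by simpa using norm_sub_le (y + w) y
    have h2 : ‖y‖ ≤ ‖x‖ + ‖y - x‖ := by simpa using norm_add_le x (y - x)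
    rw [mem_ball_iff_norm] at hyx
    linarith

/-- **Continuity of partial minimization over polyhedral domains (Corollary
`cor:polyhedral_domain_continuity`).**  Let `F : ℝⁿ → ℝ ∪ {∞}` be coercive, lower
semicontinuous, and continuous on its domain, and assume `K = dom F` is a (not necessarily
closed) convex polyhedron `{x | ⟨bᵢ, x⟩ ◁ᵢ cᵢ}` where each `◁ᵢ` is `<` or `≤`.  Let `V` be
any fixed subspace of `ℝⁿ`.  Then `K` is stable with respect to translations in the constant
family `V`, and `m x = min_{v ∈ V} F (x + v)` is attained and continuous on `dom F`. -/
theorem min_over_polyhedral_domain_continuous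
    {n k : ℕ}
    (F : EuclideanSpace ℝ (Fin n) → EReal)
    (hnobot : ∀ x, F x ≠ ⊥)
    (hcoercive : ∀ c : ℝ, ∃ r : ℝ, ∀ x : EuclideanSpace ℝ (Fin n), r ≤ ‖x‖ → (c : EReal) ≤ F x)
    (hlsc : LowerSemicontinuous F)
    (hcont : ContinuousOn F {x | F x ≠ ⊤})
    (b : Fin k → EuclideanSpace ℝ (Fin n)) (c : Fin k → ℝ) (strict : Fin k → Bool)
    (hdom : {x | F x ≠ ⊤} =
      {x : EuclideanSpace ℝ (Fin n) | ∀ i : Fin k,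
        if strict i then ⟪b i, x⟫ < c i else ⟪b i, x⟫ ≤ c i})
    (V : Submodule ℝ (EuclideanSpace ℝ (Fin n))) :
    (∀ (x : EuclideanSpace ℝ (Fin n)) (xs : ℕ → EuclideanSpace ℝ (Fin n)),
      (∀ ν, F (xs ν) ≠ ⊤) → F x ≠ ⊤ → Filter.Tendsto xs Filter.atTop (nhds x) →
      (∀ (vs : ℕ → EuclideanSpace ℝ (Fin n)) (v : EuclideanSpace ℝ (Fin n)),
        (∀ ν, vs ν ∈ V) → Filter.Tendsto vs Filter.atTop (nhds v) → v ∈ V) ∧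
      (∀ v ∈ V, F (x + v) ≠ ⊤ →
        ∃ vs : ℕ → EuclideanSpace ℝ (Fin n),
          (∀ ν, vs ν ∈ V ∧ F (xs ν + vs ν) ≠ ⊤) ∧
          Filter.Tendsto vs Filter.atTop (nhds v))) ∧
    (∀ x, F x ≠ ⊤ → ∃ v ∈ V, (⨅ w ∈ V, F (x + w)) = F (x + v)) ∧
    ContinuousOn (fun x => ⨅ w ∈ V, F (x + w)) {x | F x ≠ ⊤} := by
  have mem_iff : ∀ y, F y ≠ ⊤ ↔ ∀ i : Fin k,
      if strict i then ⟪b i, y⟫ < c i else ⟪b i, y⟫ ≤ c i := fun y => Set.ext_iff.1 hdom y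
  have translate : ∀ x v, F (x + v) ≠ ⊤ → ∃ t : EuclideanSpace ℝ (Fin n) → ℝ,
      Continuous t ∧ t x = 1 ∧ ∀ y, F y ≠ ⊤ → F (y + t y • v) ≠ ⊤ := by
    simp only [mem_iff]
    exact fun x v hxv => exists_continuous_smul_translate_mem b c strict hxv
  have attained : ∀ x, F x ≠ ⊤ → ∃ v ∈ V, (⨅ w ∈ V, F (x + w)) = F (x + v) := fun x hx =>
    exists_iInf_translate_eq hnobot hcoercive hlsc V hx
  refine ⟨fun x xs hxs hx hlim => ⟨fun vs v hvs hv => ?_, fun v hv hxv => ?_⟩, attained,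
    fun x hx => ?_⟩
  · exact V.closed_of_finiteDimensional.mem_of_tendsto hv (Filter.Eventually.of_forall hvs)
  · obtain ⟨t, ht, htx, htK⟩ := translate x v hxv
    refine ⟨fun ν => t (xs ν) • v, fun ν => ⟨V.smul_mem _ hv, htK _ (hxs ν)⟩, ?_⟩
    simpa [htx] using ((ht.tendsto x).comp hlim).smul_const v
  · obtain ⟨v, hv, hmin⟩ := attained x hx
    have hxv : F (x + v) ≠ ⊤ := by
      rw [← hmin]
      refine ne_top_of_le_ne_top hx ?_
      simpa using iInf₂_le (f := fun w (_ : w ∈ V) => F (x + w)) 0 V.zero_mem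
    obtain ⟨t, ht, htx, htK⟩ := translate x v hxv
    have htend : Filter.Tendsto (fun y => F (y + t y • v)) (nhdsWithin x {x | F x ≠ ⊤})
        (nhds (F (x + v))) := by
      have hinner : ContinuousWithinAt (fun y => y + t y • v) {x | F x ≠ ⊤} x := by fun_prop
      have hF : ContinuousWithinAt F {x | F x ≠ ⊤} (x + t x • v) := by
        simpa [htx] using hcont (x + v) hxv
      simpa [ContinuousWithinAt, htx, Function.comp_def] using
        ContinuousWithinAt.comp (f := fun y => y + t y • v) hF hinner htK
    refine tendsto_order.2 ⟨fun α hα => ?_, fun α hα => ?_⟩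
    · exact nhdsWithin_le_nhds (lowerSemicontinuous_iInf_translate hcoercive hlsc V x α hα)
    · simp only [hmin, gt_iff_lt] at hα
      filter_upwards [htend.eventually_lt_const hα] with y hy
      exact (iInf₂_le (t y • v) (V.smul_mem _ hv)).trans_lt hy
end
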